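/- arXiv:1006.2720 — 2 statements merged into one kernel-verified Lean document; each statement's English description precedes it below -/
import Mathlib

section
/- Let R be an admissible ring. The Zink ring 𝕎(R) is stable under the Verschiebung v : W(R) → W(R) if and only if p ≥ 3 or p·1_R = 0. Moreover, when this condition holds: (a) for every x ∈ 𝕎(R) with w_0(x) = 0 there exists y ∈ 𝕎(R) with x = v(y), and (b) the map w_0 : 𝕎(R) → R is surjective (so that 0 → 𝕎(R) →v 𝕎(R) →w_0 R → 0 is exact, v being injective). -/
/-- A commutative ring `R` is *admissible* (for the prime `p`) if its
nilradical `N_R` is bounded nilpotent and `R_red = R/N_R` is a perfect ring of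
characteristic `p`. -/
def IsAdmissible (p : ℕ) (R : Type*) [CommRing R] : Prop :=
  (∃ m : ℕ, 1 ≤ m ∧ ∀ x ∈ nilradical R, x ^ m = 0) ∧
  (p : R ⧸ nilradical R) = 0 ∧
  Function.Bijective fun x : R ⧸ nilradical R => x ^ p

/-- `Ŵ(N_R)`: the set of Witt vectors all of whose coefficients are nilpotent
and all but finitely many are zero. -/
def hatW (p : ℕ) (R : Type*) [CommRing R] : Set (WittVector p R) :=
  {x | (∀ n, IsNilpotent (x.coeff n)) ∧ ∃ N, ∀ n ≥ N, x.coeff n = 0}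

/-- The Zink ring `𝕎(R) = {s(y) + z : y ∈ W(R_red), z ∈ Ŵ(N_R)}`, as a subset
of `W(R)`, relative to a section `s : W(R_red) → W(R)`. -/
def zinkSet (p : ℕ) [Fact p.Prime] (R : Type*) [CommRing R]
    (s : WittVector p (R ⧸ nilradical R) →+* WittVector p R) :
    Set (WittVector p R) :=
  {w | ∃ (y : WittVector p (R ⧸ nilradical R)) (z : WittVector p R),
        z ∈ hatW p R ∧ w = s y + z}

namespace WittVector
variable {p : ℕ} [hp : Fact p.Prime]

theorem coeff_teichmuller_mul {R : Type*} [CommRing R] (a : R) (x : WittVector p R) (n : ℕ) :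
    (teichmuller p a * x).coeff n = a ^ p ^ n * x.coeff n := by
  suffices H : ∀ {A : Type} [CommRing A] (g : A →+* MvPolynomial (Option ℕ) ℚ)
      (_ : Function.Injective g) (a : A) (x : WittVector p A),
      teichmuller p a * x = mk p fun n => a ^ p ^ n * x.coeff n by
    let φ : MvPolynomial (Option ℕ) ℤ →+* R :=
      (MvPolynomial.aeval fun i => Option.elim i a x.coeff).toRingHom
    have h := H (MvPolynomial.map (Int.castRingHom ℚ))
      (MvPolynomial.map_injective _ Int.cast_injective) (MvPolynomial.X none)
      (mk p fun n => MvPolynomial.X (some n))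
    have h' := congrArg (fun w => (map φ w).coeff n) h
    have hx : map φ (mk p fun n => MvPolynomial.X (some n)) = x := by
      ext n; simp [φ]
    simp only [map_mul, map_teichmuller, hx] at h'
    simpa [φ] using h'
  intro A _ g hg a x
  apply map_injective g hg
  let _ : Invertible (p : MvPolynomial (Option ℕ) ℚ) :=
    (invertibleOfNonzero (Nat.cast_ne_zero.2 hp.out.ne_zero : (p : ℚ) ≠ 0)).map
      (MvPolynomial.C : ℚ →+* MvPolynomial (Option ℕ) ℚ) |>.copy _ (by simp)
  apply (ghostMap.bijective_of_invertible p (MvPolynomial (Option ℕ) ℚ)).1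
  funext n
  rw [map_mul, map_mul, Pi.mul_apply, ghostMap_apply, ghostMap_apply, ghostMap_apply,
    map_teichmuller, ghostComponent_teichmuller]
  simp only [ghostComponent_apply, aeval_wittPolynomial, map_coeff, Finset.mul_sum]
  refine Finset.sum_congr rfl fun i hi => ?_
  have hi' : i ≤ n := Nat.lt_succ_iff.1 (Finset.mem_range.1 hi)
  rw [coeff_mk, map_mul, map_pow, mul_pow, ← pow_mul, ← pow_add, Nat.add_sub_cancel' hi']
  ring

theorem exists_eq_teichmuller_add_verschiebung {R : Type*} [CommRing R] (x : WittVector p R) :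
    ∃ y : WittVector p R, (∀ n, y.coeff n = x.coeff (n + 1)) ∧
      x = teichmuller p (x.coeff 0) + verschiebung y := by
  refine ⟨mk p fun n => x.coeff (n + 1), fun n => by simp, ?_⟩
  ext n
  rw [coeff_add_of_disjoint]
  · cases n with
    | zero => simp
    | succ n => simp [teichmuller_coeff_pos]
  · rintro (_ | n)
    · right; simp
    · left; simp [teichmuller_coeff_pos]

theorem exists_eq_verschiebung {R : Type*} [CommRing R] {x : WittVector p R}
    (hx : x.coeff 0 = 0) :
    ∃ y : WittVector p R, (∀ n, y.coeff n = x.coeff (n + 1)) ∧ x = verschiebung y := by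
  obtain ⟨y, hy, h⟩ := exists_eq_teichmuller_add_verschiebung x
  exact ⟨y, hy, by simpa [hx] using h⟩

section CoeffIdeal
variable {R : Type*} [CommRing R]

/-- The ideal of `W(R)` of Witt vectors all of whose coefficients lie in the ideal `I`. -/
noncomputable def coeffIdeal (p : ℕ) [Fact p.Prime] (I : Ideal R) : Ideal (WittVector p R) :=
  RingHom.ker (map (Ideal.Quotient.mk I))

theorem mem_coeffIdeal {I : Ideal R} {x : WittVector p R} :
    x ∈ coeffIdeal p I ↔ ∀ n, x.coeff n ∈ I := by
  simp [coeffIdeal, RingHom.mem_ker, WittVector.ext_iff, Ideal.Quotient.eq_zero_iff_mem]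

theorem verschiebung_mem_coeffIdeal {I : Ideal R} {x : WittVector p R}
    (hx : x ∈ coeffIdeal p I) : verschiebung x ∈ coeffIdeal p I := by
  rw [mem_coeffIdeal] at hx ⊢
  rintro (_ | n)
  · simp
  · simpa using hx n

theorem teichmuller_mem_coeffIdeal {I : Ideal R} {x : R}
    (hx : x ∈ I) : teichmuller p x ∈ coeffIdeal p I := by
  rw [mem_coeffIdeal]
  rintro (_ | n)
  · simpa
  · simp [teichmuller_coeff_pos]

theorem constantCoeff_frobeniusPolyAux (n : ℕ) :
    MvPolynomial.constantCoeff (frobeniusPolyAux p n) = 0 := by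
  have h : (frobenius (0 : WittVector p ℤ)).coeff n = 0 := by simp
  rw [coeff_frobenius, frobeniusPoly] at h
  have h0 : (0 : WittVector p ℤ).coeff = fun _ => 0 := by funext; simp
  have hz : MvPolynomial.aeval (fun _ => (0 : ℤ)) (frobeniusPolyAux p n) =
      MvPolynomial.constantCoeff (frobeniusPolyAux p n) := by
    simp
  rw [h0] at h
  rw [← hz]
  simpa [hp.out.ne_zero] using h

variable {I J : Ideal R} (hmul : ∀ x ∈ I, (p : R) * x ∈ J) (hpow : ∀ x ∈ I, x ^ p ∈ J)
  {w : WittVector p R}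

include hmul hpow

theorem frobenius_mem_coeffIdeal (hw : w ∈ coeffIdeal p I) : frobenius w ∈ coeffIdeal p J := by
  rw [mem_coeffIdeal] at hw ⊢
  intro n
  rw [coeff_frobenius, frobeniusPoly]
  have h : MvPolynomial.aeval w.coeff (frobeniusPolyAux p n) ∈ I := by
    rw [← Ideal.Quotient.eq_zero_iff_mem, MvPolynomial.aeval_def, MvPolynomial.hom_eval₂]
    have : (fun i => (Ideal.Quotient.mk I) (w.coeff i)) = fun _ => 0 := by
      funext i; exact Ideal.Quotient.eq_zero_iff_mem.2 (hw i)
    rw [this, MvPolynomial.eval₂_zero'_apply, constantCoeff_frobeniusPolyAux, map_zero]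
  simpa using J.add_mem (hpow _ (hw n)) (hmul _ h)

theorem natCast_mul_mem_coeffIdeal (hw : w ∈ coeffIdeal p I) :
    (p : WittVector p R) * w ∈ coeffIdeal p J := by
  obtain ⟨y, -, hy⟩ := exists_eq_teichmuller_add_verschiebung (p : WittVector p R)
  rw [hy, add_mul, ← verschiebung_mul_frobenius]
  refine Ideal.add_mem _ ?_ (verschiebung_mem_coeffIdeal
    (Ideal.mul_mem_left _ _ (frobenius_mem_coeffIdeal hmul hpow hw)))
  have h0 : (p : WittVector p R).coeff 0 = p :=
    map_natCast (constantCoeff : WittVector p R →+* R) p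
  rw [mem_coeffIdeal] at hw ⊢
  intro n
  rw [coeff_teichmuller_mul, h0, ← Nat.succ_pred (pow_ne_zero n hp.out.ne_zero), pow_succ,
    mul_assoc]
  exact J.mul_mem_left _ (hmul _ (hw n))

theorem pow_mem_coeffIdeal (hw : w ∈ coeffIdeal p I) : w ^ p ∈ coeffIdeal p J := by
  obtain ⟨u, hu, h⟩ := exists_eq_teichmuller_add_verschiebung w
  have huI : u ∈ coeffIdeal p I := mem_coeffIdeal.2 fun n => hu n ▸ mem_coeffIdeal.1 hw _
  have haI := teichmuller_mem_coeffIdeal (p := p) (mem_coeffIdeal.1 hw 0)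
  rw [h, add_pow_prime_eq hp.out, ← map_pow, mul_assoc, mul_assoc]
  refine Ideal.add_mem _ (Ideal.add_mem _ ?_ ?_) ?_
  · exact teichmuller_mem_coeffIdeal (hpow _ (mem_coeffIdeal.1 hw 0))
  · refine Ideal.mem_of_dvd _ (pow_dvd_pow _ hp.out.two_le) ?_
    rw [sq, ← verschiebung_mul_frobenius, frobenius_verschiebung, ← mul_assoc, mul_comm]
    exact verschiebung_mem_coeffIdeal
      (natCast_mul_mem_coeffIdeal hmul hpow (Ideal.mul_mem_left _ _ huI))
  · rw [← mul_assoc]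
    exact Ideal.mul_mem_right _ _ (natCast_mul_mem_coeffIdeal hmul hpow haI)

end CoeffIdeal

section HatW
variable {R : Type*} [CommRing R]

open Polynomial in
theorem exists_forall_ge_coeff_eq_zero_of_mem_adjoin {S : Set R[X]} (hS : S.Finite)
    (hnil : ∀ q ∈ S, IsNilpotent q) {u : WittVector p R}
    (hu : ∀ n, (teichmuller p X * map C u).coeff n ∈ Algebra.adjoin R S) :
    ∃ N, ∀ n ≥ N, u.coeff n = 0 := by
  have hfg := fg_adjoin_of_finite (R := R) hS fun q hq => by
    obtain ⟨m, hm⟩ := hnil q hq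
    exact ⟨Polynomial.X ^ m, Polynomial.monic_X_pow m, by simp [hm]⟩
  obtain ⟨t, ht⟩ := hfg
  obtain ⟨d, hd⟩ := span_of_finite_le_degreeLT (R := R) t.finite_toSet
  refine ⟨d, fun n hn => ?_⟩
  have h := hu n
  rw [coeff_teichmuller_mul, map_coeff, ← Subalgebra.mem_toSubmodule, ← ht] at h
  have h' := mem_degreeLT.1 (hd h)
  have hlt : d ≤ p ^ n := hn.trans (Nat.lt_pow_self hp.out.one_lt).le
  have := coeff_eq_zero_of_degree_lt (h'.trans_le (Nat.cast_le.2 hlt))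
  simpa using this

theorem hatW_subset_coeffIdeal {x : WittVector p R} (hx : x ∈ hatW p R) :
    x ∈ coeffIdeal p (nilradical R) :=
  mem_coeffIdeal.2 hx.1

open Polynomial in
theorem isNilpotent_coeff_teichmuller_X_mul {x : WittVector p R} (hx : x ∈ hatW p R) :
    ∀ q ∈ Set.range (teichmuller p X * map C x).coeff, IsNilpotent q := by
  rintro _ ⟨n, rfl⟩
  rw [coeff_teichmuller_mul, map_coeff]
  exact (Commute.all _ _).isNilpotent_mul_left ((hx.1 n).map C)

open Polynomial in
theorem finite_range_coeff_teichmuller_X_mul {x : WittVector p R} (hx : x ∈ hatW p R) :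
    (Set.range (teichmuller p X * map C x).coeff).Finite := by
  obtain ⟨N, hN⟩ := hx.2
  refine (((Set.finite_lt_nat N).image (teichmuller p X * map C x).coeff).insert 0).subset ?_
  rintro _ ⟨n, rfl⟩
  by_cases hn : n < N
  · exact Or.inr ⟨n, hn, rfl⟩
  · left
    rw [coeff_teichmuller_mul, map_coeff, hN n (not_lt.1 hn), map_zero, mul_zero]

theorem exists_map_subalgebra_val_eq {A : Type*} [CommRing A] [Algebra R A] {B : Subalgebra R A}
    {x : WittVector p A} (hx : ∀ n, x.coeff n ∈ B) :
    ∃ y : WittVector p B, map B.val.toRingHom y = x :=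
  ⟨mk p fun n => ⟨x.coeff n, hx n⟩, by ext n; simp⟩

theorem coeff_add_mem_subalgebra {A : Type*} [CommRing A] [Algebra R A] {B : Subalgebra R A}
    {x y : WittVector p A} (hx : ∀ n, x.coeff n ∈ B) (hy : ∀ n, y.coeff n ∈ B) (n : ℕ) :
    (x + y).coeff n ∈ B := by
  obtain ⟨x, rfl⟩ := exists_map_subalgebra_val_eq hx
  obtain ⟨y, rfl⟩ := exists_map_subalgebra_val_eq hy
  rw [← map_add, map_coeff]
  exact ((x + y).coeff n).2

theorem coeff_mul_mem_subalgebra {A : Type*} [CommRing A] [Algebra R A] {B : Subalgebra R A}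
    {x y : WittVector p A} (hx : ∀ n, x.coeff n ∈ B) (hy : ∀ n, y.coeff n ∈ B) (n : ℕ) :
    (x * y).coeff n ∈ B := by
  obtain ⟨x, rfl⟩ := exists_map_subalgebra_val_eq hx
  obtain ⟨y, rfl⟩ := exists_map_subalgebra_val_eq hy
  rw [← map_mul, map_coeff]
  exact ((x * y).coeff n).2

open Polynomial in
theorem add_mem_hatW {x y : WittVector p R} (hx : x ∈ hatW p R) (hy : y ∈ hatW p R) :
    x + y ∈ hatW p R := by
  refine ⟨mem_coeffIdeal.1 (Ideal.add_mem _ (hatW_subset_coeffIdeal hx)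
    (hatW_subset_coeffIdeal hy)), ?_⟩
  refine exists_forall_ge_coeff_eq_zero_of_mem_adjoin
    ((finite_range_coeff_teichmuller_X_mul hx).union (finite_range_coeff_teichmuller_X_mul hy))
    (fun q hq => hq.elim (isNilpotent_coeff_teichmuller_X_mul hx q)
      (isNilpotent_coeff_teichmuller_X_mul hy q)) fun n => ?_
  rw [map_add, mul_add]
  exact coeff_add_mem_subalgebra
    (fun i => Algebra.subset_adjoin (Set.mem_union_left _ (Set.mem_range_self i)))
    (fun i => Algebra.subset_adjoin (Set.mem_union_right _ (Set.mem_range_self i))) n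

open Polynomial in
theorem mul_mem_hatW (r : WittVector p R) {x : WittVector p R} (hx : x ∈ hatW p R) :
    r * x ∈ hatW p R := by
  refine ⟨mem_coeffIdeal.1 (Ideal.mul_mem_left _ r (hatW_subset_coeffIdeal hx)), ?_⟩
  refine exists_forall_ge_coeff_eq_zero_of_mem_adjoin
    (finite_range_coeff_teichmuller_X_mul hx) (isNilpotent_coeff_teichmuller_X_mul hx) fun n => ?_
  rw [map_mul, mul_left_comm]
  refine coeff_mul_mem_subalgebra (fun i => ?_)
    (fun i => Algebra.subset_adjoin (Set.mem_range_self i)) n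
  rw [map_coeff]
  exact Subalgebra.algebraMap_mem _ _

theorem neg_mem_hatW {x : WittVector p R} (hx : x ∈ hatW p R) : -x ∈ hatW p R := by
  simpa using mul_mem_hatW (-1) hx

theorem verschiebung_mem_hatW {x : WittVector p R} (hx : x ∈ hatW p R) :
    verschiebung x ∈ hatW p R := by
  obtain ⟨hnil, N, hN⟩ := hx
  refine ⟨?_, N + 1, ?_⟩
  · rintro (_ | n)
    · simp
    · simpa using hnil n
  · rintro (_ | n) hn
    · simp
    · simpa using hN n (by omega)

theorem exists_mem_hatW_eq_verschiebung {x : WittVector p R} (hx : x ∈ hatW p R)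
    (h0 : x.coeff 0 = 0) : ∃ y ∈ hatW p R, x = verschiebung y := by
  obtain ⟨y, hy, h⟩ := exists_eq_verschiebung h0
  obtain ⟨hnil, N, hN⟩ := hx
  exact ⟨y, ⟨fun n => hy n ▸ hnil _, N, fun n hn => hy n ▸ hN _ (by omega)⟩, h⟩

theorem teichmuller_mem_hatW {r : R} (hr : IsNilpotent r) : teichmuller p r ∈ hatW p R := by
  refine ⟨mem_coeffIdeal.1 (teichmuller_mem_coeffIdeal (mem_nilradical.2 hr)), 1, fun n hn => ?_⟩
  exact teichmuller_coeff_pos p r n hn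

end HatW

section Uniqueness
variable {R : Type*} [CommRing R]

/-- The ideal generated by the products `p ^ i * x ^ p ^ j` with `x ∈ I` and `i + j = t`. -/
def primePowIdeal (p : ℕ) (I : Ideal R) (t : ℕ) : Ideal R :=
  Ideal.span {y | ∃ i j : ℕ, ∃ x ∈ I, i + j = t ∧ y = (p : R) ^ i * x ^ p ^ j}

omit hp in
theorem le_primePowIdeal_zero (I : Ideal R) : I ≤ primePowIdeal p I 0 := fun x hx =>
  Ideal.subset_span ⟨0, 0, x, hx, rfl, by simp⟩

omit hp in
theorem natCast_mul_mem_primePowIdeal_succ {I : Ideal R} {t : ℕ} :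
    ∀ x ∈ primePowIdeal p I t, (p : R) * x ∈ primePowIdeal p I (t + 1) := by
  intro x hx
  induction hx using Submodule.span_induction with
  | mem x h =>
    obtain ⟨i, j, y, hy, rfl, rfl⟩ := h
    exact Ideal.subset_span ⟨i + 1, j, y, hy, by omega, by ring⟩
  | zero => simp
  | add x y _ _ hx hy => rw [mul_add]; exact Ideal.add_mem _ hx hy
  | smul a x _ hx =>
    rw [smul_eq_mul, mul_left_comm]
    exact Ideal.mul_mem_left _ _ hx

theorem pow_mem_primePowIdeal_succ {I : Ideal R} {t : ℕ} :
    ∀ x ∈ primePowIdeal p I t, x ^ p ∈ primePowIdeal p I (t + 1) := by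
  intro x hx
  induction hx using Submodule.span_induction with
  | mem x h =>
    obtain ⟨i, j, y, hy, rfl, rfl⟩ := h
    have : ((p : R) ^ i * y ^ p ^ j) ^ p =
        (p : R) ^ (i * (p - 1)) * ((p : R) ^ i * y ^ p ^ (j + 1)) := by
      obtain ⟨q, hq⟩ := Nat.exists_eq_add_of_le' hp.out.one_le
      rw [mul_pow, ← pow_mul, ← pow_mul, ← pow_succ, ← mul_assoc, ← pow_add]
      congr 2
      rw [hq]; simp; ring
    rw [this]
    exact Ideal.mul_mem_left _ _ (Ideal.subset_span ⟨i, j + 1, y, hy, by omega, rfl⟩)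
  | zero => simp [hp.out.ne_zero]
  | add x y hx' _ hx hy =>
    rw [add_pow_prime_eq hp.out]
    refine Ideal.add_mem _ (Ideal.add_mem _ hx hy) ?_
    rw [mul_assoc]
    exact Ideal.mul_mem_right _ _ (natCast_mul_mem_primePowIdeal_succ x hx')
  | smul a x _ hx =>
    rw [smul_eq_mul, mul_pow]
    exact Ideal.mul_mem_left _ _ hx

theorem primePowIdeal_eq_bot {I : Ideal R} {e m : ℕ} (he : (p : R) ^ e = 0)
    (hm : ∀ x ∈ I, x ^ m = 0) : primePowIdeal p I (e + m) = ⊥ := by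
  rw [primePowIdeal, Ideal.span_eq_bot]
  rintro _ ⟨i, j, x, hx, hij, rfl⟩
  by_cases hi : e ≤ i
  · rw [pow_eq_zero_of_le hi he, zero_mul]
  · rw [pow_eq_zero_of_le (le_trans (by omega) (Nat.lt_pow_self hp.out.one_lt).le) (hm x hx),
      mul_zero]

theorem exists_eq_teichmuller_pow_add_natCast_mul {k : Type*} [CommRing k] [CharP k p]
    [PerfectRing k p] (x : WittVector p k) :
    ∃ (c : k) (u : WittVector p k), x = teichmuller p c ^ p + p * u := by
  obtain ⟨y, -, hy⟩ := exists_eq_teichmuller_add_verschiebung x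
  obtain ⟨u, rfl⟩ := (frobenius_bijective p k).2 y
  obtain ⟨c, hc⟩ := (PerfectRing.bijective_frobenius (R := k) (p := p)).2 (x.coeff 0)
  refine ⟨c, u, ?_⟩
  replace hc : c ^ p = x.coeff 0 := hc
  rwa [← map_pow, mul_comm, ← verschiebung_frobenius, hc]

/-- Two ring homomorphisms from the Witt vectors of a perfect ring that agree modulo `W(I)` are
equal, if `p` is nilpotent and `I` is bounded nilpotent. -/
theorem ringHom_eq_of_sub_mem_coeffIdeal {k : Type*} [CommRing k] [CharP k p] [PerfectRing k p]
    {I : Ideal R} {e m : ℕ} (he : (p : R) ^ e = 0) (hm : ∀ x ∈ I, x ^ m = 0)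
    {g h : WittVector p k →+* WittVector p R} (hgh : ∀ x, g x - h x ∈ coeffIdeal p I) :
    g = h := by
  have key : ∀ t x, g x - h x ∈ coeffIdeal p (primePowIdeal p I t) := by
    intro t
    induction t with
    | zero => exact fun x => mem_coeffIdeal.2 fun n =>
        le_primePowIdeal_zero I (mem_coeffIdeal.1 (hgh x) n)
    | succ t ih =>
      intro x
      obtain ⟨c, u, rfl⟩ := exists_eq_teichmuller_pow_add_natCast_mul x
      obtain ⟨w, hw⟩ : ∃ w, w = g (teichmuller p c) - h (teichmuller p c) := ⟨_, rfl⟩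
      have hwt : w ∈ coeffIdeal p (primePowIdeal p I t) := hw ▸ ih _
      have hp_mul : ∀ z ∈ coeffIdeal p (primePowIdeal p I t),
          (p : WittVector p R) * z ∈ coeffIdeal p (primePowIdeal p I (t + 1)) := fun z hz =>
        natCast_mul_mem_coeffIdeal natCast_mul_mem_primePowIdeal_succ
          pow_mem_primePowIdeal_succ hz
      have hwp := pow_mem_coeffIdeal natCast_mul_mem_primePowIdeal_succ
          pow_mem_primePowIdeal_succ hwt
      have h1 := add_pow_prime_eq hp.out w (h (teichmuller p c))
      rw [hw, sub_add_cancel, ← hw] at h1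
      have h2 : g (teichmuller p c ^ p + p * u) - h (teichmuller p c ^ p + p * u) =
          (w ^ p + p * w * (h (teichmuller p c) * ∑ k ∈ Finset.Ioo 0 p,
            w ^ (k - 1) * h (teichmuller p c) ^ (p - k - 1) * ↑(p.choose k / p))) +
            p * (g u - h u) := by
        simp only [map_add, map_mul, map_pow, map_natCast, h1]
        ring
      rw [h2]
      exact Ideal.add_mem _ (Ideal.add_mem _ hwp (Ideal.mul_mem_right _ _ (hp_mul w hwt)))
        (hp_mul _ (ih u))
  ext1 x
  rw [← sub_eq_zero]
  ext n
  simpa [primePowIdeal_eq_bot he hm] using mem_coeffIdeal.1 (key (e + m) x) n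

end Uniqueness

section Integral

variable (p) in
theorem coeff_zero_natCast_sub_verschiebung_one :
    ((p : WittVector p ℤ) - verschiebung 1).coeff 0 = (p : ℤ) := by
  have h : constantCoeff ((p : WittVector p ℤ) - verschiebung 1) = (p : ℤ) := by
    rw [map_sub, map_natCast]
    simp [constantCoeff]
  exact h

variable (p) in
theorem sum_coeff_natCast_sub_verschiebung_one (n : ℕ) :
    ∑ i ∈ Finset.range (n + 2), (p : ℤ) ^ i *
      ((p : WittVector p ℤ) - verschiebung 1).coeff i ^ p ^ (n + 1 - i) = 0 := by
  have h : ghostComponent (n + 1) ((p : WittVector p ℤ) - verschiebung 1) = 0 := by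
    rw [map_sub, map_natCast, ghostComponent_verschiebung, map_one, mul_one, sub_self]
  rwa [ghostComponent_apply, aeval_wittPolynomial] at h

theorem pow_dvd_coeff_natCast_sub_verschiebung_one (hp3 : 3 ≤ p) (n : ℕ) :
    (p : ℤ) ^ (n + 1) ∣ ((p : WittVector p ℤ) - verschiebung 1).coeff n := by
  induction n using Nat.strong_induction_on with
  | _ n ih =>
    rcases n with _ | n
    · simp [coeff_zero_natCast_sub_verschiebung_one]
    have h := sum_coeff_natCast_sub_verschiebung_one p n
    rw [Finset.sum_range_succ, Nat.sub_self, pow_zero, pow_one] at h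
    have hd : (p : ℤ) ^ (n + 1) * p ^ (n + 2) ∣ ∑ i ∈ Finset.range (n + 1), (p : ℤ) ^ i *
        ((p : WittVector p ℤ) - verschiebung 1).coeff i ^ p ^ (n + 1 - i) := by
      refine Finset.dvd_sum fun i hi => ?_
      have hi' := Finset.mem_range.1 hi
      refine dvd_trans ?_ (mul_dvd_mul_left _ (pow_dvd_pow_of_dvd (ih i hi') _))
      rw [← pow_mul, ← pow_add, ← pow_add]
      refine pow_dvd_pow _ ?_
      obtain ⟨j, hj⟩ : ∃ j, n + 1 = i + j := ⟨n + 1 - i, by omega⟩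
      have hpj : 1 + 2 * j ≤ p ^ j := by
        have h3 : 1 + j * 2 ≤ (1 + 2) ^ j :=
          one_add_mul_le_pow_of_sq_nonneg (by simp) (by simp) (by simp) j
        calc 1 + 2 * j ≤ 3 ^ j := by simpa [mul_comm] using h3
          _ ≤ p ^ j := Nat.pow_le_pow_left hp3 j
      rw [show n + 1 - i = j by omega]
      nlinarith
    have h' : (p : ℤ) ^ (n + 1) * p ^ (n + 2) ∣
        (p : ℤ) ^ (n + 1) * ((p : WittVector p ℤ) - verschiebung 1).coeff (n + 1) :=
      (dvd_add_right hd).1 (h ▸ dvd_zero _)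
    exact (mul_dvd_mul_iff_left (pow_ne_zero _ (by exact_mod_cast hp.out.ne_zero))).1 h'

theorem exists_odd_coeff_two_sub_verschiebung_one (n : ℕ) :
    ∃ c : ℤ, Odd c ∧
      (((2 : ℕ) : WittVector 2 ℤ) - verschiebung 1).coeff n = 2 * c := by
  induction n using Nat.strong_induction_on with
  | _ n ih =>
    rcases n with _ | n
    · exact ⟨1, odd_one, by rw [coeff_zero_natCast_sub_verschiebung_one]; norm_num⟩
    have h := sum_coeff_natCast_sub_verschiebung_one 2 n
    rw [Finset.sum_range_succ, Finset.sum_range_succ, Nat.sub_self, pow_zero, pow_one] at h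
    obtain ⟨c, hc, hcn⟩ := ih n (by omega)
    have hd : (2 : ℤ) ^ (n + 3) ∣ ∑ i ∈ Finset.range n, ((2 : ℕ) : ℤ) ^ i *
        (((2 : ℕ) : WittVector 2 ℤ) - verschiebung 1).coeff i ^ 2 ^ (n + 1 - i) := by
      refine Finset.dvd_sum fun i hi => ?_
      have hi' := Finset.mem_range.1 hi
      obtain ⟨d, -, hdi⟩ := ih i (by omega)
      rw [hdi, mul_pow, ← mul_assoc, Nat.cast_ofNat, ← pow_add]
      refine Dvd.dvd.mul_right (pow_dvd_pow _ ?_) _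
      obtain ⟨j, hj⟩ : ∃ j, n = i + j + 1 := ⟨n - i - 1, by omega⟩
      rw [show n + 1 - i = j + 2 by omega, pow_add]
      have := Nat.lt_pow_self (n := j) one_lt_two
      omega
    obtain ⟨d, hd⟩ := hd
    refine ⟨-(c ^ 2 + 2 * d), ?_, ?_⟩
    · exact ((hc.pow).add_even (even_two_mul d)).neg
    · rw [hd, hcn, show n + 1 - n = 1 by omega] at h
      have h2 : (2 : ℤ) ^ (n + 1) ≠ 0 := by positivity
      apply mul_left_cancel₀ h2
      push_cast at h ⊢
      linear_combination h

end Integral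

variable {R : Type*} [CommRing R]

theorem map_intCast_natCast_sub_verschiebung_one :
    map (Int.castRingHom R) ((p : WittVector p ℤ) - verschiebung 1) =
      (p : WittVector p R) - verschiebung 1 := by
  rw [map_sub, map_natCast, map_verschiebung, map_one]

theorem coeff_natCast_sub_verschiebung_one (n : ℕ) :
    ((p : WittVector p R) - verschiebung 1).coeff n =
      ((((p : WittVector p ℤ) - verschiebung 1).coeff n : ℤ) : R) := by
  rw [← map_intCast_natCast_sub_verschiebung_one, map_coeff, eq_intCast]

theorem natCast_sub_verschiebung_one_mem_hatW (hnil : IsNilpotent (p : R))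
    (h : 3 ≤ p ∨ (p : R) = 0) : (p : WittVector p R) - verschiebung 1 ∈ hatW p R := by
  rcases h with h | h
  · obtain ⟨e, he⟩ := hnil
    refine ⟨fun n => ?_, e, fun n hn => ?_⟩ <;>
      obtain ⟨d, hd⟩ := pow_dvd_coeff_natCast_sub_verschiebung_one h n <;>
      rw [coeff_natCast_sub_verschiebung_one, hd] <;> push_cast
    · rw [pow_succ', mul_assoc]
      exact (Commute.all _ _).isNilpotent_mul_right ⟨e, he⟩
    · rw [pow_eq_zero_of_le (by omega) he, zero_mul]
  · rcases subsingleton_or_nontrivial R with hR | hR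
    · exact ⟨fun n => ⟨1, Subsingleton.elim _ _⟩, 0, fun n _ => Subsingleton.elim _ _⟩
    · have : CharP R p := (CharP.charP_iff_prime_eq_zero hp.out).2 h
      have h1 := verschiebung_frobenius (p := p) (1 : WittVector p R)
      rw [map_one, one_mul] at h1
      rw [h1, sub_self]
      exact ⟨fun n => by simp, 0, fun n _ => by simp⟩

theorem verschiebung_frobenius_eq_sub (x : WittVector p R) :
    verschiebung (frobenius x) = (p : WittVector p R) * x - ((p : WittVector p R) - verschiebung 1) * x := by
  rw [← one_mul (frobenius x), verschiebung_mul_frobenius]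
  ring

theorem two_eq_zero_of_verschiebung_one_mem {R : Type*} [CommRing R]
    (hnil : IsNilpotent ((2 : ℕ) : R))
    (h : ((2 : ℕ) : WittVector 2 R) - verschiebung 1 ∈ hatW 2 R) : ((2 : ℕ) : R) = 0 := by
  obtain ⟨-, N, hN⟩ := h
  have hN := hN N le_rfl
  obtain ⟨c, ⟨d, hd⟩, hc⟩ := exists_odd_coeff_two_sub_verschiebung_one N
  rw [coeff_natCast_sub_verschiebung_one, hc, hd] at hN
  have hu : IsUnit ((2 : ℕ) * (d : R) + 1) :=
    IsNilpotent.isUnit_add_one ((Commute.all _ _).isNilpotent_mul_right hnil)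
  rw [← hu.mul_left_eq_zero]
  push_cast at hN ⊢
  exact hN

section Section

variable {s : WittVector p (R ⧸ nilradical R) →+* WittVector p R}
  (hs : (map (Ideal.Quotient.mk (nilradical R))).comp s = RingHom.id _)
include hs

theorem map_section_apply (y : WittVector p (R ⧸ nilradical R)) :
    map (Ideal.Quotient.mk (nilradical R)) (s y) = y :=
  congrArg (fun g => g y) hs

theorem frobenius_section [CharP (R ⧸ nilradical R) p] [PerfectRing (R ⧸ nilradical R) p]
    {e m : ℕ} (he : (p : R) ^ e = 0) (hm : ∀ x ∈ nilradical R, x ^ m = 0)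
    (y : WittVector p (R ⧸ nilradical R)) : frobenius (s y) = s (frobenius y) := by
  have h : (frobenius : WittVector p R →+* _).comp s = s.comp frobenius := by
    refine ringHom_eq_of_sub_mem_coeffIdeal he hm fun x => ?_
    rw [coeffIdeal, RingHom.mem_ker, map_sub, RingHom.comp_apply, RingHom.comp_apply,
      map_section_apply hs, (frobenius_isPoly p).map, map_section_apply hs, sub_self]
  exact congrArg (fun g => g y) h

theorem map_mk_section_add (y : WittVector p (R ⧸ nilradical R)) {z : WittVector p R}
    (hz : z ∈ hatW p R) : map (Ideal.Quotient.mk (nilradical R)) (s y + z) = y := by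
  rw [map_add, map_section_apply hs, RingHom.mem_ker.1 (hatW_subset_coeffIdeal hz), add_zero]

theorem exists_mem_zinkSet_coeff_zero_eq (r : R) : ∃ x ∈ zinkSet p R s, x.coeff 0 = r := by
  obtain ⟨y, hy⟩ : ∃ y, y = s (teichmuller p (Ideal.Quotient.mk (nilradical R) r)) := ⟨_, rfl⟩
  have hn : r - y.coeff 0 ∈ nilradical R := by
    rw [← Ideal.Quotient.eq_zero_iff_mem, map_sub, ← map_coeff, hy, map_section_apply hs,
      teichmuller_coeff_zero, sub_self]
  refine ⟨y + teichmuller p (r - y.coeff 0),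
    ⟨_, _, teichmuller_mem_hatW (mem_nilradical.1 hn), by rw [hy]⟩, ?_⟩
  rw [add_coeff_zero, teichmuller_coeff_zero, add_sub_cancel]

end Section

end WittVector

open WittVector in
/-- The Zink ring `𝕎(R)` is stable under the Verschiebung if
and only if `p ≥ 3` or `p·1_R = 0`; and in that case every element of `𝕎(R)`
with vanishing zeroth component is `v` of an element of `𝕎(R)`, and
`w₀ : 𝕎(R) → R` is surjective. -/
theorem zinkSet_verschiebung_stable_iff (p : ℕ) [Fact p.Prime]
    (R : Type*) [CommRing R] (hR : IsAdmissible p R)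
    (s : WittVector p (R ⧸ nilradical R) →+* WittVector p R)
    (hs : (WittVector.map (Ideal.Quotient.mk (nilradical R))).comp s = RingHom.id _) :
    ((∀ x ∈ zinkSet p R s, WittVector.verschiebung x ∈ zinkSet p R s) ↔
      (3 ≤ p ∨ (p : R) = 0)) ∧
    ((3 ≤ p ∨ (p : R) = 0) →
      Function.Injective
        (WittVector.verschiebung : WittVector p R → WittVector p R) ∧
      (∀ x ∈ zinkSet p R s, x.coeff 0 = 0 →
        ∃ y ∈ zinkSet p R s, x = WittVector.verschiebung y) ∧
      (∀ r : R, ∃ x ∈ zinkSet p R s, x.coeff 0 = r)) := by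
  obtain ⟨⟨m, -, hm⟩, hchar, hperf⟩ := hR
  have hpN : (p : R) ∈ nilradical R := by
    rw [← Ideal.Quotient.eq_zero_iff_mem, map_natCast, hchar]
  have he : (p : R) ^ m = 0 := hm _ hpN
  have hnil : IsNilpotent (p : R) := ⟨m, he⟩
  rcases subsingleton_or_nontrivial R with hsub | hnt
  · have : Subsingleton (WittVector p R) :=
      ⟨fun x y => WittVector.ext fun n => Subsingleton.elim _ _⟩
    have hmem : ∀ x, x ∈ zinkSet p R s := fun x =>
      ⟨0, 0, ⟨fun n => by simp, 0, fun n _ => by simp⟩, Subsingleton.elim _ _⟩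
    exact ⟨⟨fun _ => Or.inr (Subsingleton.elim _ _), fun _ x _ => hmem _⟩, fun _ =>
      ⟨verschiebung_injective p R, fun x _ _ => ⟨0, hmem 0, Subsingleton.elim _ _⟩,
        exists_mem_zinkSet_coeff_zero_eq hs⟩⟩
  have : Nontrivial (R ⧸ nilradical R) :=
    Ideal.Quotient.nontrivial_iff.2 fun h => one_ne_zero (α := R) <| by
      simpa using hm 1 (h ▸ Submodule.mem_top)
  have : CharP (R ⧸ nilradical R) p :=
    (CharP.charP_iff_prime_eq_zero Fact.out).2 (by simpa using hchar)
  have : PerfectRing (R ⧸ nilradical R) p := ⟨hperf⟩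
  have hfs := frobenius_section hs he hm
  refine ⟨⟨fun hstable => ?_, fun hp => ?_⟩, fun hp => ⟨verschiebung_injective p R, ?_,
    exists_mem_zinkSet_coeff_zero_eq hs⟩⟩
  · by_cases hp3 : 3 ≤ p
    · exact Or.inl hp3
    right
    have hp2 : 2 ≤ p := (Fact.out : p.Prime).two_le
    obtain rfl : p = 2 := by omega
    obtain ⟨y, z, hz, h⟩ := hstable 1 ⟨1, 0, ⟨fun n => by simp, 0, fun n _ => by simp⟩, by simp⟩
    have hy := map_mk_section_add hs y hz
    rw [← h, map_verschiebung, map_one, ← map_one WittVector.frobenius, verschiebung_frobenius, one_mul]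
      at hy
    rw [← hy, map_natCast] at h
    apply two_eq_zero_of_verschiebung_one_mem hnil
    rw [h, sub_add_cancel_left]
    exact neg_mem_hatW hz
  · rintro _ ⟨y, z, hz, rfl⟩
    obtain ⟨u, rfl⟩ := (frobenius_bijective p _).2 y
    refine ⟨p * u, -(((p : WittVector p R) - verschiebung 1) * s u) + verschiebung z,
      add_mem_hatW (neg_mem_hatW ?_) (verschiebung_mem_hatW hz), ?_⟩
    · rw [mul_comm]
      exact mul_mem_hatW _ (natCast_sub_verschiebung_one_mem_hatW hnil hp)
    · rw [map_add, ← hfs, verschiebung_frobenius_eq_sub, map_mul, map_natCast]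
      ring
  · rintro _ ⟨y, z, hz, rfl⟩ h0
    have hy0 : y.coeff 0 = 0 := by
      rw [← map_mk_section_add hs y hz, map_coeff, h0, map_zero]
    obtain ⟨y', -, rfl⟩ := exists_eq_verschiebung hy0
    obtain ⟨u, rfl⟩ := (frobenius_bijective p _).2 y'
    have hz' : s u * ((p : WittVector p R) - verschiebung 1) + z ∈ hatW p R :=
      add_mem_hatW (mul_mem_hatW _ (natCast_sub_verschiebung_one_mem_hatW hnil hp)) hz
    have hx : s (verschiebung (frobenius u)) + z = verschiebung (s (frobenius u)) +
        (s u * ((p : WittVector p R) - verschiebung 1) + z) := by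
      rw [← hfs, verschiebung_frobenius_eq_sub (s u), verschiebung_frobenius, map_mul,
        map_natCast]
      ring
    rw [hx, add_coeff_zero, verschiebung_coeff_zero, zero_add] at h0
    obtain ⟨z', hz', hzz'⟩ := exists_mem_hatW_eq_verschiebung hz' h0
    exact ⟨s (frobenius u) + z', ⟨_, _, hz', rfl⟩, by rw [hx, hzz', map_add]⟩
end

section
/- Let R be an admissible ring. Then the kernel of the composite ring homomorphism 𝕎(R) → R → R_red (first applying w_0, then reducing modulo the nilradical) is contained in the Jacobson radical of 𝕎(R); equivalently, for every x ∈ 𝕎(R) with w_0(x) ∈ N_R and every y ∈ 𝕎(R), the element 1 + x·y is a unit of 𝕎(R). -/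
namespace WittVector

variable {p : ℕ} [Fact p.Prime] {R : Type*} [CommRing R]

theorem verschiebung_mul_verschiebung (x y : WittVector p R) :
    verschiebung x * verschiebung y = p * verschiebung (x * y) := by
  rw [← verschiebung_mul_frobenius, frobenius_verschiebung, ← mul_assoc, mul_comm (x * y),
    ← nsmul_eq_mul, map_nsmul, nsmul_eq_mul]

theorem verschiebung_pow_succ (x : WittVector p R) (n : ℕ) :
    verschiebung x ^ (n + 1) = (p : WittVector p R) ^ n * verschiebung (x ^ (n + 1)) := by
  induction n with
  | zero => simp
  | succ n ih =>
    rw [pow_succ, ih, mul_assoc, verschiebung_mul_verschiebung, ← pow_succ, ← mul_assoc,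
      ← pow_succ]

theorem isNilpotent_verschiebung {x : WittVector p R} (hx : IsNilpotent x) :
    IsNilpotent (verschiebung x) := by
  obtain ⟨n, hn⟩ := hx
  refine ⟨n + 1, ?_⟩
  rw [verschiebung_pow_succ, pow_succ, hn, zero_mul, map_zero, mul_zero]

theorem isNilpotent_teichmuller {r : R} (hr : IsNilpotent r) :
    IsNilpotent (teichmuller p r) := by
  obtain ⟨n, hn⟩ := hr
  exact ⟨n + 1, by rw [← map_pow, pow_succ, hn, zero_mul, teichmuller_zero]⟩

theorem teichmuller_add_verschiebung_shift (x : WittVector p R) :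
    teichmuller p (x.coeff 0) + verschiebung (x.shift 1) = x := by
  ext n
  rw [coeff_add_of_disjoint]
  · cases n with
    | zero => simp
    | succ n =>
      rw [teichmuller_coeff_pos _ _ _ n.succ_pos, zero_add, verschiebung_coeff_succ, shift_coeff,
        add_comm]
  · rintro (_ | n)
    · exact Or.inr (verschiebung_coeff_zero _)
    · exact Or.inl (teichmuller_coeff_pos _ _ _ n.succ_pos)

/-- A Witt vector with nilpotent coefficients, almost all of which vanish, is nilpotent. -/
theorem isNilpotent_of_coeff {x : WittVector p R} (hx : ∀ n, IsNilpotent (x.coeff n)) {N : ℕ}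
    (hN : ∀ n ≥ N, x.coeff n = 0) : IsNilpotent x := by
  induction N generalizing x with
  | zero =>
    rw [show x = 0 from WittVector.ext fun n => by simpa using hN n n.zero_le]
    exact IsNilpotent.zero
  | succ N ih =>
    rw [← teichmuller_add_verschiebung_shift x]
    refine (Commute.all _ _).isNilpotent_add (isNilpotent_teichmuller (hx 0))
      (isNilpotent_verschiebung (ih (fun n => ?_) fun n hn => ?_))
    · exact hx _
    · exact hN _ (by lia)

/-- Over a perfect ring `k` of characteristic `p`, the kernel of `W(k) → k` lies in the Jacobson
radical. -/
theorem isUnit_one_add_mul_of_coeff_zero {k : Type*} [CommRing k] [CharP k p] [PerfectRing k p]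
    {x : WittVector p k} (hx : x.coeff 0 = 0) (y : WittVector p k) : IsUnit (1 + x * y) := by
  rw [add_comm]
  exact Ideal.mem_jacobson_bot.mp
    (IsAdicComplete.le_jacobson_bot _ ((mem_span_p_iff_coeff_zero_eq_zero x).mpr hx)) y

end WittVector

section Zink

variable {p : ℕ} [Fact p.Prime] {R : Type*} [CommRing R]

theorem map_eq_zero_of_mem_hatW {z : WittVector p R} (hz : z ∈ hatW p R) :
    WittVector.map (Ideal.Quotient.mk (nilradical R)) z = 0 := by
  ext n
  rw [WittVector.map_coeff, WittVector.zero_coeff]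
  exact Ideal.Quotient.eq_zero_iff_mem.mpr (hz.1 n)

theorem section_mem_zinkSet (s : WittVector p (R ⧸ nilradical R) →+* WittVector p R)
    (y : WittVector p (R ⧸ nilradical R)) : s y ∈ zinkSet p R s :=
  ⟨y, 0, ⟨fun n => by simp, 0, fun n _ => by simp⟩, by simp⟩

theorem isNilpotent_of_mem_zinkSet
    {s : WittVector p (R ⧸ nilradical R) →+* WittVector p R}
    (hs : (WittVector.map (Ideal.Quotient.mk (nilradical R))).comp s = RingHom.id _)
    {w : WittVector p R} (hw : w ∈ zinkSet p R s)
    (h : WittVector.map (Ideal.Quotient.mk (nilradical R)) w = 0) : IsNilpotent w := by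
  obtain ⟨y, z, hz, rfl⟩ := hw
  rw [map_add, map_eq_zero_of_mem_hatW hz, add_zero] at h
  have hy : y = 0 := (RingHom.congr_fun hs y).symm.trans h
  obtain ⟨hnil, N, hN⟩ := hz
  rw [hy, map_zero, zero_add]
  exact WittVector.isNilpotent_of_coeff hnil hN

theorem isUnit_of_isUnit_map {s : WittVector p (R ⧸ nilradical R) →+* WittVector p R}
    (hs : (WittVector.map (Ideal.Quotient.mk (nilradical R))).comp s = RingHom.id _)
    {S : Subring (WittVector p R)} (hS : (S : Set (WittVector p R)) = zinkSet p R s) {u : S}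
    (hu : IsUnit (WittVector.map (Ideal.Quotient.mk (nilradical R)) (u : WittVector p R))) :
    IsUnit u := by
  obtain ⟨b, hb⟩ := hu.exists_right_inv
  have mem_iff (w : WittVector p R) : w ∈ S ↔ w ∈ zinkSet p R s := by
    rw [← hS, SetLike.mem_coe]
  let t : S := ⟨s b, (mem_iff _).mpr (section_mem_zinkSet s b)⟩
  have hsb : WittVector.map (Ideal.Quotient.mk (nilradical R)) (s b) = b :=
    RingHom.congr_fun hs b
  have hnil : IsNilpotent (u * t - 1) := by
    rw [← IsNilpotent.map_iff S.subtype_injective]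
    refine isNilpotent_of_mem_zinkSet hs ((mem_iff _).mp (u * t - 1).2) ?_
    change WittVector.map _ ((u : WittVector p R) * s b - 1) = 0
    rw [map_sub, map_mul, map_one, hsb, hb, sub_self]
  have : IsUnit (u * t) := by simpa using hnil.isUnit_add_one
  exact isUnit_of_mul_isUnit_left this

end Zink

/-- For an admissible ring `R`, the kernel of
`𝕎(R) → R → R_red` is contained in the Jacobson radical of `𝕎(R)`;
equivalently, `1 + x·y` is a unit for every `x` in this kernel and every
`y ∈ 𝕎(R)`. -/
theorem zink_kernel_subset_jacobson (p : ℕ) [Fact p.Prime]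
    (R : Type*) [CommRing R] (hR : IsAdmissible p R)
    (s : WittVector p (R ⧸ nilradical R) →+* WittVector p R)
    (hs : (WittVector.map (Ideal.Quotient.mk (nilradical R))).comp s = RingHom.id _)
    (S : Subring (WittVector p R)) (hS : (S : Set (WittVector p R)) = zinkSet p R s) :
    (∀ x : S, (x : WittVector p R).coeff 0 ∈ nilradical R →
      x ∈ Ideal.jacobson (⊥ : Ideal S)) ∧
    (∀ x y : S, (x : WittVector p R).coeff 0 ∈ nilradical R →
      IsUnit (1 + x * y)) := by
  have key : ∀ x y : S, (x : WittVector p R).coeff 0 ∈ nilradical R → IsUnit (1 + x * y) := by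
    intro x y hx
    apply isUnit_of_isUnit_map hs hS
    obtain ⟨-, hp, hperf⟩ := hR
    rw [S.coe_add, S.coe_mul, S.coe_one, map_add, map_mul, map_one]
    cases subsingleton_or_nontrivial (R ⧸ nilradical R) with
    | inl _ =>
      have : Subsingleton (WittVector p (R ⧸ nilradical R)) :=
        ⟨fun a b => WittVector.ext fun n => Subsingleton.elim _ _⟩
      exact isUnit_of_subsingleton _
    | inr _ =>
      have : CharP (R ⧸ nilradical R) p :=
        ringChar.of_eq (CharP.ringChar_of_prime_eq_zero Fact.out hp)
      have : PerfectRing (R ⧸ nilradical R) p := ⟨hperf⟩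
      refine WittVector.isUnit_one_add_mul_of_coeff_zero ?_ _
      rw [WittVector.map_coeff]
      exact Ideal.Quotient.eq_zero_iff_mem.mpr hx
  refine ⟨fun x hx => Ideal.mem_jacobson_bot.mpr fun y => ?_, key⟩
  rw [add_comm]
  exact key x y hx
end
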